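/- Let σ > 0, Δ > σ, and let μ be a nonzero real number. Then there exists a real λ with |λ| > 2σ, sign(λ) = −sign(μ), and λ − μ = Δ²·𝔤_σ(λ) if and only if Δ > √2·σ and |μ| < Δ²/σ − 2σ. In that case this solution is unique and is given by λ = (−2μσ² + Δ²μ − sign(μ)·Δ²·√(μ² + 4(Δ² − σ²))) / (2(Δ² − σ²)). -/

import Mathlib

/-- The Stieltjes transform of the semicircle law of variance `s ^ 2`,
    `𝔤_s(l) = (l - sign(l) * √(l² - 4 s²)) / (2 s²)`, for real `l` with `|l| > 2 s`. -/
noncomputable def stieltjes (s l : ℝ) : ℝ :=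
  (l - Real.sign l * Real.sqrt (l ^ 2 - 4 * s ^ 2)) / (2 * s ^ 2)

lemma stieltjes_neg (s l : ℝ) : stieltjes s (-l) = -stieltjes s l := by
  simp only [stieltjes, Real.sign_neg, neg_sq]
  ring

/-- Above the bulk, `stieltjes s` takes values in `(0, 1 / s)` and satisfies the self-consistent
equation of the semicircle law. -/
lemma stieltjes_spec {s x : ℝ} (hs : 0 < s) (hx : 2 * s < x) :
    0 < stieltjes s x ∧ s * stieltjes s x < 1 ∧
      x * stieltjes s x = 1 + s ^ 2 * stieltjes s x ^ 2 := by
  have hx0 : 0 < x := by linarith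
  have hd : 0 < x ^ 2 - 4 * s ^ 2 := by nlinarith
  have hr := Real.sqrt_pos.2 hd
  have hr2 := Real.sq_sqrt hd.le
  set r := √(x ^ 2 - 4 * s ^ 2) with hrdef
  have hg : stieltjes s x = (x - r) / (2 * s ^ 2) := by
    rw [stieltjes, Real.sign_of_pos hx0, one_mul]
  have hrx : r < x := by nlinarith [sq_pos_of_pos hs]
  have hlt : x - 2 * s < r := by nlinarith
  rw [hg]
  refine ⟨div_pos (sub_pos.2 hrx) (by positivity), ?_, ?_⟩
  · rw [← mul_div_assoc, div_lt_one (by positivity)]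
    nlinarith
  · field_simp
    linear_combination -hr2

/-- On `(0, 1 / s)` the map `g ↦ 1 / g + s² g` is a right inverse of `stieltjes s`. -/
lemma stieltjes_inv_add {s g : ℝ} (hs : 0 < s) (hg : 0 < g) (hsg : s * g < 1) :
    2 * s < 1 / g + s ^ 2 * g ∧ stieltjes s (1 / g + s ^ 2 * g) = g := by
  have hpos : 0 < 1 / g + s ^ 2 * g := by positivity
  have hsq : (1 / g + s ^ 2 * g) ^ 2 - 4 * s ^ 2 = (1 / g - s ^ 2 * g) ^ 2 := by
    field_simp
    ring
  have hnn : 0 ≤ 1 / g - s ^ 2 * g := by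
    rw [sub_nonneg, le_div_iff₀ hg]
    nlinarith [mul_pos hs hg]
  constructor
  · have h : 1 / g + s ^ 2 * g - 2 * s = (1 - s * g) ^ 2 / g := by
      field_simp
      ring
    have : 0 < (1 - s * g) ^ 2 / g := div_pos (pow_pos (sub_pos.2 hsg) 2) hg
    linarith
  · rw [stieltjes, Real.sign_of_pos hpos, hsq, Real.sqrt_sq hnn]
    field_simp
    ring

lemma pos_root_quadratic {a m g : ℝ} (ha : 0 < a) (hg : 0 < g) (h : a * g ^ 2 = m * g + 1) :
    √(m ^ 2 + 4 * a) = 2 * a * g - m := by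
  have hnn : 0 ≤ 2 * a * g - m := by
    by_contra! hlt
    nlinarith [mul_pos ha (pow_pos hg 2)]
  rw [← Real.sqrt_sq hnn]
  congr 1
  linear_combination -4 * a * h

lemma of_outlier_pos {σ Δ m x : ℝ} (hσ : 0 < σ) (hΔσ : σ < Δ) (hm : 0 < m) (hx : 2 * σ < x)
    (h : x + m = Δ ^ 2 * stieltjes σ x) :
    (√2 * σ < Δ ∧ m < Δ ^ 2 / σ - 2 * σ) ∧
      x = (2 * m * σ ^ 2 - Δ ^ 2 * m + Δ ^ 2 * √(m ^ 2 + 4 * (Δ ^ 2 - σ ^ 2))) /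
        (2 * (Δ ^ 2 - σ ^ 2)) := by
  obtain ⟨hg, hsg, hxg⟩ := stieltjes_spec hσ hx
  set g := stieltjes σ x
  have ha : 0 < Δ ^ 2 - σ ^ 2 := by nlinarith
  have hq : (Δ ^ 2 - σ ^ 2) * g ^ 2 = m * g + 1 := by linear_combination hxg - g * h
  have hlt : m < Δ ^ 2 / σ - 2 * σ := by
    have h1 : 0 < ((Δ ^ 2 - σ ^ 2) - m * σ - σ ^ 2) * g ^ 2 := by
      have : ((Δ ^ 2 - σ ^ 2) - m * σ - σ ^ 2) * g ^ 2 = (1 - σ * g) * (m * g + 1 + σ * g) := by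
        linear_combination hq
      rw [this]
      exact mul_pos (sub_pos.2 hsg) (by positivity)
    have h2 := pos_of_mul_pos_left h1 (by positivity)
    rw [lt_sub_iff_add_lt, lt_div_iff₀ hσ]
    nlinarith
  refine ⟨⟨?_, hlt⟩, ?_⟩
  · have h1 : 2 * σ < Δ ^ 2 / σ := by linarith
    rw [lt_div_iff₀ hσ] at h1
    refine lt_of_pow_lt_pow_left₀ 2 (by linarith) ?_
    rw [mul_pow, Real.sq_sqrt (by norm_num)]
    linarith
  · rw [pos_root_quadratic ha hg hq, eq_div_iff (by positivity)]
    linear_combination 2 * (Δ ^ 2 - σ ^ 2) * h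

lemma exists_outlier_pos {σ Δ m : ℝ} (hσ : 0 < σ) (hΔσ : σ < Δ) (hm : 0 < m)
    (hlt : m < Δ ^ 2 / σ - 2 * σ) :
    ∃ x, 2 * σ < x ∧ x + m = Δ ^ 2 * stieltjes σ x := by
  have ha : 0 < Δ ^ 2 - σ ^ 2 := by nlinarith
  obtain ⟨g, hg, hq⟩ : ∃ g, 0 < g ∧ (Δ ^ 2 - σ ^ 2) * g ^ 2 = m * g + 1 := by
    refine ⟨(m + √(m ^ 2 + 4 * (Δ ^ 2 - σ ^ 2))) / (2 * (Δ ^ 2 - σ ^ 2)), by positivity, ?_⟩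
    have hr := Real.sq_sqrt (show 0 ≤ m ^ 2 + 4 * (Δ ^ 2 - σ ^ 2) by positivity)
    generalize √(m ^ 2 + 4 * (Δ ^ 2 - σ ^ 2)) = r at *
    generalize Δ ^ 2 - σ ^ 2 = a at *
    field_simp
    linear_combination hr
  have hsg : σ * g < 1 := by
    rw [lt_sub_iff_add_lt, lt_div_iff₀ hσ] at hlt
    have h1 : 0 < ((Δ ^ 2 - σ ^ 2) - m * σ - σ ^ 2) * g ^ 2 :=
      mul_pos (by linarith) (by positivity)
    have h2 : ((Δ ^ 2 - σ ^ 2) - m * σ - σ ^ 2) * g ^ 2 = (1 - σ * g) * (m * g + 1 + σ * g) := by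
      linear_combination hq
    rw [h2] at h1
    linarith [pos_of_mul_pos_left h1 (by positivity)]
  obtain ⟨hx, hst⟩ := stieltjes_inv_add hσ hg hsg
  refine ⟨_, hx, ?_⟩
  rw [hst]
  field_simp
  linear_combination -hq

lemma Real.pos_of_sign_eq_one {r : ℝ} (h : r.sign = 1) : 0 < r := by
  rcases lt_trichotomy r 0 with hr | rfl | hr
  · rw [Real.sign_of_neg hr] at h; norm_num at h
  · simp at h
  · exact hr

theorem stmt_4 (σ Δ μ : ℝ) (hσ : 0 < σ) (hΔσ : σ < Δ) (hμ : μ ≠ 0) :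
    ((∃ l : ℝ, 2 * σ < |l| ∧ Real.sign l = -Real.sign μ ∧ l - μ = Δ ^ 2 * stieltjes σ l) ↔
      (Real.sqrt 2 * σ < Δ ∧ |μ| < Δ ^ 2 / σ - 2 * σ)) ∧
    (∀ l : ℝ, 2 * σ < |l| → Real.sign l = -Real.sign μ → l - μ = Δ ^ 2 * stieltjes σ l →
      l = (-(2 * μ * σ ^ 2) + Δ ^ 2 * μ -
            Real.sign μ * Δ ^ 2 * Real.sqrt (μ ^ 2 + 4 * (Δ ^ 2 - σ ^ 2))) /
          (2 * (Δ ^ 2 - σ ^ 2))) := by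
  rcases lt_or_gt_of_ne hμ with hneg | hpos
  · have hm : 0 < -μ := neg_pos.2 hneg
    simp only [Real.sign_of_neg hneg, abs_of_neg hneg, neg_neg]
    refine ⟨⟨?_, ?_⟩, ?_⟩
    · rintro ⟨l, hl, hs, h⟩
      rw [abs_of_pos (Real.pos_of_sign_eq_one hs)] at hl
      exact (of_outlier_pos hσ hΔσ hm hl (by linarith)).1
    · rintro ⟨-, hlt⟩
      obtain ⟨x, hx, h⟩ := exists_outlier_pos hσ hΔσ hm hlt
      have hx0 : 0 < x := by linarith
      exact ⟨x, by rwa [abs_of_pos hx0], Real.sign_of_pos hx0, by linarith⟩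
    · intro l hl hs h
      rw [abs_of_pos (Real.pos_of_sign_eq_one hs)] at hl
      rw [(of_outlier_pos hσ hΔσ hm hl (by linarith)).2, neg_sq]
      ring
  · simp only [Real.sign_of_pos hpos, abs_of_pos hpos]
    have hsign {l : ℝ} (hs : l.sign = -1) : 0 < -l :=
      Real.pos_of_sign_eq_one (by rw [Real.sign_neg, hs, neg_neg])
    refine ⟨⟨?_, ?_⟩, ?_⟩
    · rintro ⟨l, hl, hs, h⟩
      rw [abs_of_neg (neg_pos.1 (hsign hs))] at hl
      exact (of_outlier_pos hσ hΔσ hpos hl (by rw [stieltjes_neg]; linarith)).1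
    · rintro ⟨-, hlt⟩
      obtain ⟨x, hx, h⟩ := exists_outlier_pos hσ hΔσ hpos hlt
      have hx0 : 0 < x := by linarith
      exact ⟨-x, by rwa [abs_neg, abs_of_pos hx0], by rw [Real.sign_neg, Real.sign_of_pos hx0],
        by rw [stieltjes_neg]; linarith⟩
    · intro l hl hs h
      rw [abs_of_neg (neg_pos.1 (hsign hs))] at hl
      rw [← neg_neg l,
        (of_outlier_pos hσ hΔσ hpos hl (by rw [stieltjes_neg]; linarith)).2, ← neg_div]
      ring
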